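/- Graphs generated by the SG-generating algorithm induce the marginal and conditional independence model: for a summary graph H = (N,F) and pairwise disjoint subsets A, B, C, C₁, M of N, A ⊥_m B | C₁ holds in α_SG(H;M,C) if and only if A ⊥_m B | C∪C₁ holds in H. -/

import Mathlib

/-!
Stable mixed graphs: mixed graphs with arrows, arcs and lines; ribbonless,
summary and ancestral graphs; the generating maps α_RG, α_SG, α_AG;
m-connecting paths, m-separation and induced independence models.
-/

namespace StableMixedGraphs

/-- A mixed graph on node type `V`: a node set together with three edge
relations: arrows (`arrow i j` means an arrow from `i` to `j`), arcs
(two-headed, symmetric) and lines (undirected, symmetric). -/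
structure MixedGraph (V : Type) where
  nodes : Set V
  arrow : V → V → Prop
  arc : V → V → Prop
  line : V → V → Prop

namespace MixedGraph

variable {V W : Type}

/-- Wellformedness: arcs and lines are symmetric relations and all edges join
nodes of the graph. -/
def Wf (G : MixedGraph V) : Prop :=
  (∀ i j, G.arc i j → G.arc j i) ∧
  (∀ i j, G.line i j → G.line j i) ∧
  (∀ i j, G.arrow i j ∨ G.arc i j ∨ G.line i j → i ∈ G.nodes ∧ j ∈ G.nodes)

/-- No loops of any of the three kinds. -/
def Loopless (G : MixedGraph V) : Prop :=
  ∀ i, ¬ G.arrow i i ∧ ¬ G.arc i i ∧ ¬ G.line i i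

/-- A loopless mixed graph with a finite node set. -/
def IsLMG (G : MixedGraph V) : Prop := G.Wf ∧ G.Loopless ∧ G.nodes.Finite

/-- `G.anc i j` : `i` is an ancestor of `j`, i.e. there is a
direction-preserving path from `i` to `j`. -/
def anc (G : MixedGraph V) (i j : V) : Prop := Relation.TransGen G.arrow i j

/-- The set of ancestors of nodes of `C`. -/
def anSet (G : MixedGraph V) (C : Set V) : Set V := {a | ∃ c ∈ C, G.anc a c}

/-- `i` lies on a direction-preserving cycle. -/
def OnDPCycle (G : MixedGraph V) (i : V) : Prop := G.anc i i

/-- `i` is an endpoint of a line. -/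
def LineEndpoint (G : MixedGraph V) (i : V) : Prop := ∃ j, G.line i j

/-- Condition (2) of a ribbon: `i` or a descendant of `i` is an endpoint of a
line or lies on a direction-preserving cycle. -/
def RibbonTail (G : MixedGraph V) (i : V) : Prop :=
  ∃ d, (d = i ∨ G.anc i d) ∧ (G.LineEndpoint d ∨ G.OnDPCycle d)

/-- `G` contains a ribbon: a collider V-configuration `⟨h,i,j⟩` with no
endpoint-identical edge between `h` and `j`, whose inner node `i` (or a
descendant of it) is an endpoint of a line or on a direction-preserving
cycle. -/
def HasRibbon (G : MixedGraph V) : Prop :=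
  ∃ h i j, h ≠ i ∧ i ≠ j ∧ h ≠ j ∧ G.RibbonTail i ∧
    ((G.arc h i ∧ G.arc i j ∧ ¬ G.arc h j) ∨
     (G.arrow h i ∧ G.arrow j i ∧ ¬ G.line h j) ∨
     (G.arrow h i ∧ G.arc i j ∧ ¬ G.arrow h j))

/-- A ribbonless graph: a loopless mixed graph with no ribbon. -/
def IsRG (G : MixedGraph V) : Prop := G.IsLMG ∧ ¬ G.HasRibbon

/-- A directed acyclic graph: only arrows, no direction-preserving cycle. -/
def IsDAG (G : MixedGraph V) : Prop :=
  G.IsLMG ∧ (∀ i j, ¬ G.arc i j) ∧ (∀ i j, ¬ G.line i j) ∧ ∀ i, ¬ G.anc i i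

/-- A summary graph: a loopless mixed graph with no arrowhead pointing to an
endpoint of a line and no direction-preserving cycle. -/
def IsSG (G : MixedGraph V) : Prop :=
  G.IsLMG ∧ (∀ i, G.LineEndpoint i → ∀ k, ¬ G.arrow k i ∧ ¬ G.arc k i) ∧
    ∀ i, ¬ G.anc i i

/-- A simple mixed graph: no loops and no multiple edges. -/
def Simple (G : MixedGraph V) : Prop :=
  G.Loopless ∧ ∀ i j,
    (G.arrow i j → ¬ G.arrow j i ∧ ¬ G.arc i j ∧ ¬ G.line i j) ∧
    (G.arc i j → ¬ G.line i j)

/-- An ancestral graph: a simple mixed graph such that no node is an ancestor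
of one of its parents or spouses, and a node with a neighbour has neither
parents nor spouses. -/
def IsAG (G : MixedGraph V) : Prop :=
  G.Wf ∧ G.Simple ∧ G.nodes.Finite ∧
  (∀ i j, G.arrow j i ∨ G.arc j i → ¬ G.anc i j) ∧
  (∀ i, G.LineEndpoint i → ∀ k, ¬ G.arrow k i ∧ ¬ G.arc k i)

/-- An undirected graph: only lines. -/
def IsUG (G : MixedGraph V) : Prop :=
  G.IsLMG ∧ (∀ i j, ¬ G.arrow i j) ∧ ∀ i j, ¬ G.arc i j

/-- A bidirected graph: only arcs. -/
def IsBG (G : MixedGraph V) : Prop :=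
  G.IsLMG ∧ (∀ i j, ¬ G.arrow i j) ∧ ∀ i j, ¬ G.line i j

/-- Image of a mixed graph under a map of node types. -/
def map (f : V → W) (G : MixedGraph V) : MixedGraph W where
  nodes := f '' G.nodes
  arrow a b := ∃ i j, G.arrow i j ∧ f i = a ∧ f j = b
  arc a b := ∃ i j, G.arc i j ∧ f i = a ∧ f j = b
  line a b := ∃ i j, G.line i j ∧ f i = a ∧ f j = b

end MixedGraph

/-! ### The closure generating new edges (Table 1 of the RG-generating
algorithm), for given marginalisation set `M` and collider set
`S = C ∪ an(C)`.  For every V-configuration whose inner node is a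
non-collider in `M` (rows 1–7) or a collider in `S` (rows 8–10) the
endpoint-identical edge between the endpoints is generated, repeatedly
until closure. -/

mutual
  /-- Generated arrows (`GenArrow H M S j i`: arrow from `j` to `i`). -/
  inductive GenArrow {V : Type} (H : MixedGraph V) (M S : Set V) : V → V → Prop
    | base {i j : V} : H.arrow i j → GenArrow H M S i j
    | row1 {i j m : V} : m ∈ M → j ≠ i →
        GenArrow H M S j m → GenArrow H M S m i → GenArrow H M S j i
    | row2 {i j m : V} : m ∈ M → j ≠ i →
        GenLine H M S j m → GenArrow H M S m i → GenArrow H M S j i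
    | row3 {i j m : V} : m ∈ M → j ≠ i →
        GenLine H M S j m → GenArc H M S m i → GenArrow H M S j i
    | row8 {i j s : V} : s ∈ S → j ≠ i →
        GenArrow H M S j s → GenArc H M S s i → GenArrow H M S j i

  /-- Generated arcs. -/
  inductive GenArc {V : Type} (H : MixedGraph V) (M S : Set V) : V → V → Prop
    | base {i j : V} : H.arc i j → GenArc H M S i j
    | symm {i j : V} : GenArc H M S i j → GenArc H M S j i
    | row4 {i j m : V} : m ∈ M → i ≠ j →
        GenArrow H M S m i → GenArrow H M S m j → GenArc H M S i j
    | row5 {i j m : V} : m ∈ M → i ≠ j →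
        GenArrow H M S m i → GenArc H M S m j → GenArc H M S i j
    | row9 {i j s : V} : s ∈ S → i ≠ j →
        GenArc H M S i s → GenArc H M S s j → GenArc H M S i j

  /-- Generated lines. -/
  inductive GenLine {V : Type} (H : MixedGraph V) (M S : Set V) : V → V → Prop
    | base {i j : V} : H.line i j → GenLine H M S i j
    | symm {i j : V} : GenLine H M S i j → GenLine H M S j i
    | row6 {i j m : V} : m ∈ M → i ≠ j →
        GenLine H M S i m → GenArrow H M S j m → GenLine H M S i j
    | row7 {i j m : V} : m ∈ M → i ≠ j →
        GenLine H M S i m → GenLine H M S m j → GenLine H M S i j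
    | row10 {i j s : V} : s ∈ S → i ≠ j →
        GenArrow H M S i s → GenArrow H M S j s → GenLine H M S i j
end

variable {V : Type}

/-- The RG-generating map `α_RG(H;M,C)`: generate all edges of the closure
and delete the nodes of `M ∪ C`. -/
def alphaRG (H : MixedGraph V) (M C : Set V) : MixedGraph V where
  nodes := H.nodes \ (M ∪ C)
  arrow i j := i ∈ H.nodes \ (M ∪ C) ∧ j ∈ H.nodes \ (M ∪ C) ∧
    GenArrow H M (C ∪ H.anSet C) i j
  arc i j := i ∈ H.nodes \ (M ∪ C) ∧ j ∈ H.nodes \ (M ∪ C) ∧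
    GenArc H M (C ∪ H.anSet C) i j
  line i j := i ∈ H.nodes \ (M ∪ C) ∧ j ∈ H.nodes \ (M ∪ C) ∧
    GenLine H M (C ∪ H.anSet C) i j

/-- The arrowhead-removal operation `α_RG.SG(K;A)`: every arrowhead pointing
at a node of `A` is removed (an arrow at such a node becomes a line, an arc
becomes an arrow, an arc with both endpoints in `A` becomes a line),
repeatedly until closure. -/
def deheadAt (K : MixedGraph V) (A : Set V) : MixedGraph V where
  nodes := K.nodes
  arrow j i := i ∉ A ∧ (K.arrow j i ∨ (K.arc j i ∧ j ∈ A))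
  arc i j := K.arc i j ∧ i ∉ A ∧ j ∉ A
  line i j := K.line i j ∨ (K.arrow j i ∧ i ∈ A) ∨ (K.arrow i j ∧ j ∈ A) ∨
    (K.arc i j ∧ i ∈ A ∧ j ∈ A)

/-- The SG-generating map `α_SG(H;M,C)`: mark the nodes of `an(C)`, apply the
RG-generating construction, then remove all arrowheads pointing at marked
nodes. -/
def alphaSG (H : MixedGraph V) (M C : Set V) : MixedGraph V :=
  deheadAt (alphaRG H M C) (H.anSet C)

/-! ### Step 2 of the AG-generating algorithm: for every V-configuration
`j → k ↔ i` or `j ↔ k ↔ i` with `k ∈ an(i)` (in the current graph) generate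
an arrow from `j` to `i`, respectively an arc between `j` and `i`, until
closure. -/

mutual
  inductive AG2Arrow {V : Type} (K : MixedGraph V) : V → V → Prop
    | base {i j : V} : K.arrow j i → AG2Arrow K j i
    | gen {i j k : V} : j ≠ i → AG2Arrow K j k → AG2Arc K k i →
        AG2Anc K k i → AG2Arrow K j i

  inductive AG2Arc {V : Type} (K : MixedGraph V) : V → V → Prop
    | base {i j : V} : K.arc i j → AG2Arc K i j
    | symm {i j : V} : AG2Arc K i j → AG2Arc K j i
    | gen {i j k : V} : j ≠ i → AG2Arc K j k → AG2Arc K k i →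
        AG2Anc K k i → AG2Arc K j i

  /-- The ancestor relation of the graph being generated in step 2. -/
  inductive AG2Anc {V : Type} (K : MixedGraph V) : V → V → Prop
    | single {i j : V} : AG2Arrow K i j → AG2Anc K i j
    | tail {i k j : V} : AG2Arrow K i k → AG2Anc K k j → AG2Anc K i j
end

/-- The graph after step 2 of the AG-generating algorithm. -/
def ag2 (K : MixedGraph V) : MixedGraph V where
  nodes := K.nodes
  arrow := AG2Arrow K
  arc := AG2Arc K
  line := K.line

/-! ### Step 3 of the AG-generating algorithm: repeatedly replace every arc
between `j` and `i` with `j ∈ an(i)` (in the current graph) by an arrow from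
`j` to `i`. -/

mutual
  inductive AG3Arrow {V : Type} (K : MixedGraph V) : V → V → Prop
    | base {i j : V} : K.arrow j i → AG3Arrow K j i
    | conv {i j : V} : K.arc j i → AG3Anc K j i → AG3Arrow K j i

  /-- The ancestor relation of the graph being generated in step 3. -/
  inductive AG3Anc {V : Type} (K : MixedGraph V) : V → V → Prop
    | single {i j : V} : AG3Arrow K i j → AG3Anc K i j
    | tail {i k j : V} : AG3Arrow K i k → AG3Anc K k j → AG3Anc K i j
end

/-- Steps 2 and 3 of the AG-generating algorithm, applied to a summary
graph: `α_SG.AG`. -/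
def alphaSGAG (K : MixedGraph V) : MixedGraph V :=
  let K2 := ag2 K
  { nodes := K.nodes
    arrow := AG3Arrow K2
    arc := fun i j => K2.arc i j ∧ ¬ AG3Anc K2 i j ∧ ¬ AG3Anc K2 j i
    line := K.line }

/-- The AG-generating map `α_AG(H;M,C)`. -/
def alphaAG (H : MixedGraph V) (M C : Set V) : MixedGraph V :=
  alphaSGAG (alphaSG H M C)

/-! ### Paths, m-connection and m-separation. -/

/-- A step of a walk: it goes from `src` to `tgt` along an edge which has an
arrowhead at `src` iff `hs = true` and an arrowhead at `tgt` iff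
`ht = true` (so `hs = ht = false` is a line, `hs = ht = true` an arc, and
exactly one head an arrow in the corresponding direction). -/
structure Step (V : Type) where
  src : V
  tgt : V
  hs : Bool
  ht : Bool

/-- The edge of a step is present in `G`. -/
def Step.valid (G : MixedGraph V) (s : Step V) : Prop :=
  match s.hs, s.ht with
  | false, false => G.line s.src s.tgt
  | false, true  => G.arrow s.src s.tgt
  | true,  false => G.arrow s.tgt s.src
  | true,  true  => G.arc s.src s.tgt

/-- `w` is a path from `i` to `j` in `G`: a nonempty chained list of valid
steps with no repeated nodes. -/
def IsPath (G : MixedGraph V) (i j : V) (w : List (Step V)) : Prop :=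
  w ≠ [] ∧ (∀ s ∈ w, s.valid G) ∧ List.Chain' (fun a b => a.tgt = b.src) w ∧
    w.head?.map Step.src = some i ∧ w.getLast?.map Step.tgt = some j ∧
    (i :: w.map Step.tgt).Nodup

/-- The path `w` is m-connecting given `M` and `C`: every inner collider node
is in `C ∪ an(C)` and every inner non-collider node is in `M`. -/
def MConnPath (G : MixedGraph V) (M C : Set V) (w : List (Step V)) : Prop :=
  List.Chain'
    (fun a b =>
      (a.ht = true ∧ b.hs = true → a.tgt ∈ C ∪ G.anSet C) ∧
      (¬ (a.ht = true ∧ b.hs = true) → a.tgt ∈ M)) w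

/-- `A ⊥_m B | C` in `G` : there is no m-connecting path between `A` and `B`
given `C` (with `M` the remaining nodes). -/
def MSep (G : MixedGraph V) (A B C : Set V) : Prop :=
  ∀ i ∈ A, ∀ j ∈ B, ∀ w : List (Step V),
    IsPath G i j w → ¬ MConnPath G (G.nodes \ (A ∪ B ∪ C)) C w

/-- The independence model induced by `G` via m-separation: the set of
triples `⟨A,B|C⟩` of pairwise disjoint subsets of the nodes with
`A ⊥_m B | C`. -/
def Jm (G : MixedGraph V) : Set (Set V × Set V × Set V) :=
  {t | t.1 ⊆ G.nodes ∧ t.2.1 ⊆ G.nodes ∧ t.2.2 ⊆ G.nodes ∧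
    Disjoint t.1 t.2.1 ∧ Disjoint t.1 t.2.2 ∧ Disjoint t.2.1 t.2.2 ∧
    MSep G t.1 t.2.1 t.2.2}

/-- The independence model after marginalisation over `M` and conditioning on
`C` : `α(J;M,C)`. -/
def alphaIM (J : Set (Set V × Set V × Set V)) (M C : Set V) :
    Set (Set V × Set V × Set V) :=
  {t | (t.1, t.2.1, t.2.2 ∪ C) ∈ J ∧ (t.1 ∪ t.2.1 ∪ t.2.2) ∩ (M ∪ C) = ∅}

/-! ### Walks over an abstract family of edges with arrowhead marks -/

/-- The m-connection condition at an inner node `x` of a walk: `x` lies in `S` if both adjacent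
edges point to it, and in `M` otherwise. -/
def InnerOk (M S : Set V) (h₁ h₂ : Bool) (x : V) : Prop :=
  (h₁ = true ∧ h₂ = true → x ∈ S) ∧ (¬ (h₁ = true ∧ h₂ = true) → x ∈ M)

/-- `w` is a walk from `i` to `j` along `E`, where `E a ha b hb` is an edge between `a` and `b`
with an arrowhead at `a` iff `ha` and at `b` iff `hb`. -/
def IsWalk (E : V → Bool → V → Bool → Prop) : V → List (Step V) → V → Prop
  | i, [], j => i = j
  | i, s :: w, j => s.src = i ∧ E s.src s.hs s.tgt s.ht ∧ IsWalk E s.tgt w j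

/-- Consecutive steps of `w` satisfy the m-connection condition. -/
def IsConnecting (M S : Set V) (w : List (Step V)) : Prop :=
  List.IsChain (fun a b => InnerOk M S a.ht b.hs a.tgt) w

/-- `Conn E M S a ha b hb`: `a` and `b` are joined by an m-connecting walk whose arrowheads at the
endpoints are given by `ha` and `hb`. -/
inductive Conn (E : V → Bool → V → Bool → Prop) (M S : Set V) : V → Bool → V → Bool → Prop
  | base {a b : V} {ha hb : Bool} : E a ha b hb → Conn E M S a ha b hb
  | trans {a x b : V} {ha hx hx' hb : Bool} : Conn E M S a ha x hx → InnerOk M S hx hx' x →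
      Conn E M S x hx' b hb → Conn E M S a ha b hb

theorem InnerOk.symm {M S : Set V} {h₁ h₂ : Bool} {x : V} (h : InnerOk M S h₁ h₂ x) :
    InnerOk M S h₂ h₁ x :=
  ⟨fun h' => h.1 h'.symm, fun h' => h.2 fun h'' => h' h''.symm⟩

theorem Conn.symm {E : V → Bool → V → Bool → Prop} {M S : Set V}
    (hE : ∀ a ha b hb, E a ha b hb → E b hb a ha) {a b : V} {ha hb : Bool}
    (h : Conn E M S a ha b hb) : Conn E M S b hb a ha := by
  induction h with
  | base h => exact .base (hE _ _ _ _ h)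
  | trans _ ho _ ih₁ ih₂ => exact .trans ih₂ ho.symm ih₁

theorem isWalk_append {E : V → Bool → V → Bool → Prop} {u w : List (Step V)} {i j : V} :
    IsWalk E i (u ++ w) j ↔ ∃ k, IsWalk E i u k ∧ IsWalk E k w j := by
  induction u generalizing i with
  | nil => simp [IsWalk]
  | cons s u ih => simp [IsWalk, ih, and_assoc]

theorem Conn.exists_walk {E : V → Bool → V → Bool → Prop} {M S : Set V} {a b : V} {ha hb : Bool}
    (h : Conn E M S a ha b hb) : ∃ w : List (Step V), IsWalk E a w b ∧ IsConnecting M S w ∧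
      (∃ s ∈ w.head?, s.hs = ha) ∧ ∃ s ∈ w.getLast?, s.ht = hb ∧ s.tgt = b := by
  induction h with
  | @base a b ha hb h => exact ⟨[⟨a, b, ha, hb⟩], by simp [IsWalk, h, IsConnecting]⟩
  | trans _ ho _ ih₁ ih₂ =>
    obtain ⟨w₁, hw₁, hc₁, ⟨s₁, hs₁, e₁⟩, t₁, ht₁, f₁, g₁⟩ := ih₁
    obtain ⟨w₂, hw₂, hc₂, ⟨s₂, hs₂, e₂⟩, t₂, ht₂, f₂, g₂⟩ := ih₂
    refine ⟨w₁ ++ w₂, isWalk_append.2 ⟨_, hw₁, hw₂⟩, List.isChain_append.2 ⟨hc₁, hc₂, ?_⟩,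
      ⟨s₁, ?_, e₁⟩, t₂, ?_, f₂, g₂⟩
    · intro x hx y hy
      obtain rfl := Option.mem_unique hx ht₁
      obtain rfl := Option.mem_unique hy hs₂
      rw [f₁, g₁, e₂]
      exact ho
    · simp_all [List.head?_append]
    · simp_all [List.getLast?_append]

theorem IsWalk.exists_split {E : V → Bool → V → Bool → Prop} {w : List (Step V)} {i j v : V}
    (h : IsWalk E i w j) (hv : v ∈ w.map Step.tgt) :
    ∃ w₁ w₂, w = w₁ ++ w₂ ∧ w₁ ≠ [] ∧ IsWalk E i w₁ v ∧ IsWalk E v w₂ j := by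
  obtain ⟨s, hs, rfl⟩ := List.mem_map.1 hv
  obtain ⟨w₁, w₂, rfl⟩ := List.append_of_mem hs
  obtain ⟨k, hk, e, he, hw⟩ := isWalk_append.1 h
  exact ⟨w₁ ++ [s], w₂, by simp, by simp, isWalk_append.2 ⟨k, hk, e, he, rfl⟩, hw⟩

theorem IsWalk.exists_loop {E : V → Bool → V → Bool → Prop} {w : List (Step V)} {i j : V}
    (h : IsWalk E i w j) (hd : ¬ (i :: w.map Step.tgt).Nodup) :
    ∃ v w₁ w₂ w₃, w = w₁ ++ (w₂ ++ w₃) ∧ w₂ ≠ [] ∧ IsWalk E i w₁ v ∧ IsWalk E v w₂ v ∧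
      IsWalk E v w₃ j := by
  induction w generalizing i with
  | nil => simp at hd
  | cons s w ih =>
    by_cases hi : i ∈ (s :: w).map Step.tgt
    · obtain ⟨w₂, w₃, e, hne, h₂, h₃⟩ := h.exists_split hi
      exact ⟨i, [], w₂, w₃, e, hne, rfl, h₂, h₃⟩
    · obtain ⟨e, he, hw⟩ := h
      have hd' : ¬ (s.tgt :: w.map Step.tgt).Nodup := fun hn => hd (List.nodup_cons.2 ⟨hi, hn⟩)
      obtain ⟨v, w₁, w₂, w₃, rfl, hne, h₁, h₂, h₃⟩ := ih hw hd'
      exact ⟨v, s :: w₁, w₂, w₃, rfl, hne, ⟨e, he, h₁⟩, h₂, h₃⟩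

/-- A connecting walk that leaves a node with an arrowhead along a tail and does not end with an
arrowhead runs into a collider, so that its starting node belongs to `S`. -/
theorem IsWalk.start_mem {E : V → Bool → V → Bool → Prop} {M S : Set V}
    (hE : ∀ a ha b hb, E a ha b hb → E b hb a ha)
    (hline : ∀ x y z h, E x false y false → ¬ E x true z h)
    (hanc : ∀ x y, E x false y true → y ∈ S → x ∈ S)
    {w : List (Step V)} {i j : V} (h : IsWalk E i w j) (hc : IsConnecting M S w)
    (hi : ∃ z b, E i true z b) (hf : ∀ s ∈ w.head?, s.hs = false)
    (hl : ∀ s ∈ w.getLast?, s.ht = false) (hne : w ≠ []) : i ∈ S := by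
  induction w generalizing i with
  | nil => exact absurd rfl hne
  | cons s w ih =>
    obtain ⟨rfl, he, hw⟩ := h
    have hs : s.hs = false := hf s rfl
    obtain ⟨z, b, hz⟩ := hi
    rw [hs] at he
    have ht : s.ht = true := by
      by_contra ht
      rw [Bool.not_eq_true] at ht
      rw [ht] at he
      exact hline _ _ _ _ he hz
    rw [ht] at he
    refine hanc _ _ he ?_
    cases w with
    | nil => simp [ht] at hl
    | cons t w =>
      obtain ⟨ho, hc⟩ := List.isChain_cons_cons.1 hc
      cases hts : t.hs with
      | true => exact ho.1 ⟨ht, hts⟩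
      | false =>
        exact ih hw hc ⟨_, _, hE _ _ _ _ he⟩ (by simpa using hts) (by simpa using hl) (by simp)

theorem IsWalk.exists_nodup {E : V → Bool → V → Bool → Prop} {M S : Set V}
    (hE : ∀ a ha b hb, E a ha b hb → E b hb a ha)
    (hline : ∀ x y z h, E x false y false → ¬ E x true z h)
    (hanc : ∀ x y, E x false y true → y ∈ S → x ∈ S)
    {w : List (Step V)} {i j : V} (h : IsWalk E i w j) (hc : IsConnecting M S w) :
    ∃ w', IsWalk E i w' j ∧ IsConnecting M S w' ∧ (i :: w'.map Step.tgt).Nodup := by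
  induction hn : w.length using Nat.strong_induction_on generalizing w with
  | _ n ih =>
    by_cases hd : (i :: w.map Step.tgt).Nodup
    · exact ⟨w, h, hc, hd⟩
    obtain ⟨v, w₁, w₂, w₃, rfl, hne, h₁, h₂, h₃⟩ := h.exists_loop hd
    have hlen : (w₁ ++ w₃).length < n := by
      have := List.length_pos_iff.2 hne
      simp only [List.length_append] at hn ⊢
      omega
    refine ih _ hlen (isWalk_append.2 ⟨v, h₁, h₃⟩) ?_ rfl
    obtain ⟨c₁, c₂₃, j₁⟩ := List.isChain_append.1 hc
    obtain ⟨c₂, c₃, j₂⟩ := List.isChain_append.1 c₂₃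
    refine List.isChain_append.2 ⟨c₁, c₃, ?_⟩
    intro x hx y hy
    obtain ⟨w₁', rfl⟩ := List.mem_getLast?_eq_getLast hx |>.elim fun hw e =>
      (⟨w₁.dropLast, by rw [e, List.dropLast_append_getLast hw]⟩ : ∃ u, w₁ = u ++ [x])
    obtain ⟨k, -, rfl, hex, hxv⟩ := isWalk_append.1 h₁
    change x.tgt = v at hxv
    subst hxv
    obtain ⟨p, w₂', rfl⟩ := List.exists_cons_of_ne_nil hne
    obtain ⟨q, hq⟩ : ∃ q, q ∈ (p :: w₂').getLast? :=
      ⟨_, List.getLast?_eq_getLast_of_ne_nil hne⟩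
    have o₁ : InnerOk M S x.ht p.hs x.tgt := j₁ x hx p (by simp)
    have o₂ : InnerOk M S q.ht y.hs q.tgt := j₂ q hq y hy
    have hqt : q.tgt = x.tgt := by
      obtain ⟨u, e⟩ := List.mem_getLast?_eq_getLast hq |>.elim fun hw e =>
        (⟨(p :: w₂').dropLast, by rw [e, List.dropLast_append_getLast hw]⟩ :
          ∃ u, p :: w₂' = u ++ [q])
      rw [e] at h₂
      obtain ⟨k, -, -, -, hqv⟩ := isWalk_append.1 h₂
      exact hqv
    rw [hqt] at o₂
    refine ⟨fun ⟨hxt, hyt⟩ => ?_, fun hnc => ?_⟩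
    · cases hp : p.hs with
      | true => exact o₁.1 ⟨hxt, hp⟩
      | false =>
        cases hqh : q.ht with
        | true => exact o₂.1 ⟨hqh, hyt⟩
        | false =>
          refine h₂.start_mem hE hline hanc c₂ ⟨x.src, x.hs, ?_⟩ (by simpa using hp) ?_ hne
          · rw [hxt] at hex
            exact hE _ _ _ _ hex
          · intro s hs
            obtain rfl := Option.mem_unique hs hq
            exact hqh
    · by_cases hxt : x.ht = true
      · exact o₂.2 fun h' => hnc ⟨hxt, h'.2⟩
      · exact o₁.2 fun h' => hxt h'.1

theorem IsWalk.mono_of_nodup {E E' : V → Bool → V → Bool → Prop}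
    (hEE' : ∀ a ha b hb, E a ha b hb → a ≠ b → E' a ha b hb) {w : List (Step V)} {i j : V}
    (h : IsWalk E i w j) (hd : (i :: w.map Step.tgt).Nodup) : IsWalk E' i w j := by
  induction w generalizing i with
  | nil => exact h
  | cons s w ih =>
    obtain ⟨rfl, he, hw⟩ := h
    obtain ⟨hn, hd⟩ := List.nodup_cons.1 hd
    refine ⟨rfl, hEE' _ _ _ _ he fun e => hn ?_, ih hw hd⟩
    rw [e]
    simp

theorem IsWalk.conn {E : V → Bool → V → Bool → Prop} {M S : Set V} {s : Step V}
    {w : List (Step V)} {i j : V} (h : IsWalk E i (s :: w) j) (hc : IsConnecting M S (s :: w)) :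
    ∃ hj, Conn E M S i s.hs j hj := by
  induction w generalizing i s with
  | nil =>
    obtain ⟨rfl, he, rfl⟩ := h
    exact ⟨_, .base he⟩
  | cons t w ih =>
    obtain ⟨rfl, he, hw⟩ := h
    obtain ⟨ho, hc⟩ := List.isChain_cons_cons.1 hc
    obtain ⟨hj, hh⟩ := ih hw hc
    exact ⟨hj, .trans (.base he) ho hh⟩

/-! ### Paths of a mixed graph as walks -/

/-- The edges of a mixed graph with their arrowhead marks. -/
def MixedGraph.Edge (G : MixedGraph V) (a : V) (ha : Bool) (b : V) (hb : Bool) : Prop :=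
  Step.valid G ⟨a, b, ha, hb⟩

theorem isWalk_edge_iff {G : MixedGraph V} {w : List (Step V)} {i j : V} (hne : w ≠ []) :
    IsWalk G.Edge i w j ↔ (∀ s ∈ w, s.valid G) ∧ List.IsChain (fun a b => a.tgt = b.src) w ∧
      w.head?.map Step.src = some i ∧ w.getLast?.map Step.tgt = some j := by
  induction w generalizing i with
  | nil => exact absurd rfl hne
  | cons s w ih =>
    cases w with
    | nil =>
      simp only [IsWalk, MixedGraph.Edge]
      simp
      tauto
    | cons t w =>
      rw [IsWalk, ih (by simp)]
      simp only [MixedGraph.Edge, List.isChain_cons_cons, List.forall_mem_cons, List.head?_cons,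
        Option.map_some, Option.some.injEq, List.getLast?_cons_cons]
      constructor
      · rintro ⟨a, b, ⟨c, d⟩, e, f, g⟩
        exact ⟨⟨b, c, d⟩, ⟨f.symm, e⟩, a, g⟩
      · rintro ⟨⟨b, c, d⟩, ⟨f, e⟩, a, g⟩
        exact ⟨a, b, ⟨c, d⟩, e, f.symm, g⟩

theorem isPath_iff {G : MixedGraph V} {w : List (Step V)} {i j : V} :
    IsPath G i j w ↔ w ≠ [] ∧ IsWalk G.Edge i w j ∧ (i :: w.map Step.tgt).Nodup := by
  unfold IsPath
  constructor
  · rintro ⟨a, b, c, d, e, f⟩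
    exact ⟨a, (isWalk_edge_iff a).2 ⟨b, c, d, e⟩, f⟩
  · rintro ⟨a, b, f⟩
    obtain ⟨b, c, d, e⟩ := (isWalk_edge_iff a).1 b
    exact ⟨a, b, c, d, e, f⟩

theorem mConnPath_iff {G : MixedGraph V} {M C : Set V} {w : List (Step V)} :
    MConnPath G M C w ↔ IsConnecting M (C ∪ G.anSet C) w := Iff.rfl

/-- Removing repeated nodes from a connecting walk whose edges are those of `G`, up to loops. -/
theorem Conn.exists_path {G : MixedGraph V} {E : V → Bool → V → Bool → Prop} {M C : Set V}
    (hE : ∀ a ha b hb, E a ha b hb → E b hb a ha)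
    (hline : ∀ x y z h, E x false y false → ¬ E x true z h)
    (hEG : ∀ a ha b hb, E a ha b hb → a ≠ b → G.Edge a ha b hb)
    (hloop : ∀ a, ¬ E a false a true)
    {i j : V} {hi hj : Bool} (h : Conn E M (C ∪ G.anSet C) i hi j hj) (hij : i ≠ j) :
    ∃ w, IsPath G i j w ∧ MConnPath G M C w := by
  obtain ⟨w, hw, hc, -⟩ := h.exists_walk
  have hanc : ∀ x y, E x false y true → y ∈ C ∪ G.anSet C → x ∈ C ∪ G.anSet C := by
    intro x y hxy hy
    have hne : x ≠ y := by
      rintro rfl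
      exact hloop _ hxy
    have hG : G.arrow x y := hEG _ _ _ _ hxy hne
    right
    rcases hy with hy | ⟨c, hc, hyc⟩
    · exact ⟨y, hy, .single hG⟩
    · exact ⟨c, hc, .head hG hyc⟩
  obtain ⟨w', hw', hc', hd⟩ := hw.exists_nodup hE hline hanc hc
  refine ⟨w', isPath_iff.2 ⟨?_, hw'.mono_of_nodup hEG hd, hd⟩, mConnPath_iff.2 hc'⟩
  rintro rfl
  exact hij hw'

theorem MixedGraph.Edge.symm {G : MixedGraph V} (hG : G.Wf) {a b : V} {ha hb : Bool}
    (h : G.Edge a ha b hb) : G.Edge b hb a ha := by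
  cases ha <;> cases hb
  · exact hG.2.1 _ _ h
  · exact h
  · exact h
  · exact hG.1 _ _ h

theorem MixedGraph.Edge.ne {G : MixedGraph V} (hG : G.Loopless) {a b : V} {ha hb : Bool}
    (h : G.Edge a ha b hb) : a ≠ b := by
  rintro rfl
  cases ha <;> cases hb
  · exact (hG a).2.2 h
  · exact (hG a).1 h
  · exact (hG a).1 h
  · exact (hG a).2.1 h

theorem MixedGraph.IsSG.not_lineEndpoint {H : MixedGraph V} (hH : H.IsSG) {a b : V} {hb : Bool}
    (h : H.Edge a true b hb) : ¬ H.LineEndpoint a := by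
  intro hl
  cases hb
  · exact (hH.2.1 a hl b).1 h
  · exact (hH.2.1 a hl b).2 (hH.1.1.1 _ _ h)

/-! ### Generated edges -/

/-- The generated edges with their arrowhead marks. -/
def GenEdge (H : MixedGraph V) (M S : Set V) (a : V) (ha : Bool) (b : V) (hb : Bool) : Prop :=
  match ha, hb with
  | false, false => GenLine H M S a b
  | false, true => GenArrow H M S a b
  | true, false => GenArrow H M S b a
  | true, true => GenArc H M S a b

theorem GenEdge.base {H : MixedGraph V} {M S : Set V} {a b : V} {ha hb : Bool}
    (h : H.Edge a ha b hb) : GenEdge H M S a ha b hb := by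
  cases ha <;> cases hb
  · exact GenLine.base h
  · exact GenArrow.base h
  · exact GenArrow.base h
  · exact GenArc.base h

theorem GenEdge.symm {H : MixedGraph V} {M S : Set V} {a b : V} {ha hb : Bool}
    (h : GenEdge H M S a ha b hb) : GenEdge H M S b hb a ha := by
  cases ha <;> cases hb
  · exact GenLine.symm h
  · exact h
  · exact h
  · exact GenArc.symm h

theorem GenEdge.trans {H : MixedGraph V} {M S : Set V} {a x b : V} {ha hx hx' hb : Bool}
    (h₁ : GenEdge H M S a ha x hx) (ho : InnerOk M S hx hx' x) (h₂ : GenEdge H M S x hx' b hb)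
    (hab : a ≠ b) : GenEdge H M S a ha b hb := by
  have hba := hab.symm
  cases hx <;> cases hx'
  · have hm : x ∈ M := ho.2 (by simp)
    cases ha <;> cases hb
    · exact GenLine.row7 hm hab h₁ h₂
    · exact GenArrow.row2 hm hab h₁ h₂
    · exact GenArrow.row2 hm hba (GenLine.symm h₂) h₁
    · exact GenArc.row4 hm hab h₁ h₂
  · have hm : x ∈ M := ho.2 (by simp)
    cases ha <;> cases hb
    · exact GenLine.row6 hm hab h₁ h₂
    · exact GenArrow.row3 hm hab h₁ h₂
    · exact GenArrow.row1 hm hba h₂ h₁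
    · exact GenArc.row5 hm hab h₁ h₂
  · have hm : x ∈ M := ho.2 (by simp)
    cases ha <;> cases hb
    · exact GenLine.symm (GenLine.row6 hm hba (GenLine.symm h₂) h₁)
    · exact GenArrow.row1 hm hab h₁ h₂
    · exact GenArrow.row3 hm hba (GenLine.symm h₂) (GenArc.symm h₁)
    · exact GenArc.symm (GenArc.row5 hm hba h₂ (GenArc.symm h₁))
  · have hs : x ∈ S := ho.1 (by simp)
    cases ha <;> cases hb
    · exact GenLine.row10 hs hab h₁ h₂
    · exact GenArrow.row8 hs hab h₁ h₂
    · exact GenArrow.row8 hs hba h₂ (GenArc.symm h₁)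
    · exact GenArc.row9 hs hab h₁ h₂

/-- `T` is a symmetric relation that contains the edges of `H` and is closed under the generation
of edges. -/
structure GenClosed (H : MixedGraph V) (M S : Set V) (T : V → Bool → V → Bool → Prop) : Prop where
  base : ∀ {a ha b hb}, H.Edge a ha b hb → T a ha b hb
  symm : ∀ {a ha b hb}, T a ha b hb → T b hb a ha
  trans : ∀ {a ha x hx hx' b hb}, T a ha x hx → InnerOk M S hx hx' x → T x hx' b hb → a ≠ b →
    T a ha b hb

theorem InnerOk.of_nonCollider {M S : Set V} {h₁ h₂ : Bool} {x : V} (hx : x ∈ M)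
    (h : ¬ (h₁ = true ∧ h₂ = true)) : InnerOk M S h₁ h₂ x :=
  ⟨fun h' => absurd h' h, fun _ => hx⟩

theorem InnerOk.of_collider {M S : Set V} {x : V} (hx : x ∈ S) : InnerOk M S true true x :=
  ⟨fun _ => hx, fun h => absurd ⟨rfl, rfl⟩ h⟩

mutual
theorem GenClosed.of_arrow {H : MixedGraph V} {M S : Set V} {T : V → Bool → V → Bool → Prop}
    (hT : GenClosed H M S T) {a b : V} : GenArrow H M S a b → T a false b true
  | .base h => hT.base h
  | .row1 hm hab h₁ h₂ =>
    hT.trans (hT.of_arrow h₁) (.of_nonCollider hm (by simp)) (hT.of_arrow h₂) hab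
  | .row2 hm hab h₁ h₂ =>
    hT.trans (hT.of_line h₁) (.of_nonCollider hm (by simp)) (hT.of_arrow h₂) hab
  | .row3 hm hab h₁ h₂ =>
    hT.trans (hT.of_line h₁) (.of_nonCollider hm (by simp)) (hT.of_arc h₂) hab
  | .row8 hs hab h₁ h₂ =>
    hT.trans (hT.of_arrow h₁) (.of_collider hs) (hT.of_arc h₂) hab

theorem GenClosed.of_arc {H : MixedGraph V} {M S : Set V} {T : V → Bool → V → Bool → Prop}
    (hT : GenClosed H M S T) {a b : V} : GenArc H M S a b → T a true b true
  | .base h => hT.base h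
  | .symm h => hT.symm (hT.of_arc h)
  | .row4 hm hab h₁ h₂ =>
    hT.trans (hT.symm (hT.of_arrow h₁)) (.of_nonCollider hm (by simp)) (hT.of_arrow h₂) hab
  | .row5 hm hab h₁ h₂ =>
    hT.trans (hT.symm (hT.of_arrow h₁)) (.of_nonCollider hm (by simp)) (hT.of_arc h₂) hab
  | .row9 hs hab h₁ h₂ =>
    hT.trans (hT.of_arc h₁) (.of_collider hs) (hT.of_arc h₂) hab

theorem GenClosed.of_line {H : MixedGraph V} {M S : Set V} {T : V → Bool → V → Bool → Prop}
    (hT : GenClosed H M S T) {a b : V} : GenLine H M S a b → T a false b false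
  | .base h => hT.base h
  | .symm h => hT.symm (hT.of_line h)
  | .row6 hm hab h₁ h₂ =>
    hT.trans (hT.of_line h₁) (.of_nonCollider hm (by simp)) (hT.symm (hT.of_arrow h₂)) hab
  | .row7 hm hab h₁ h₂ =>
    hT.trans (hT.of_line h₁) (.of_nonCollider hm (by simp)) (hT.of_line h₂) hab
  | .row10 hs hab h₁ h₂ =>
    hT.trans (hT.of_arrow h₁) (.of_collider hs) (hT.symm (hT.of_arrow h₂)) hab
end

theorem GenClosed.of_genEdge {H : MixedGraph V} {M S : Set V} {T : V → Bool → V → Bool → Prop}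
    (hT : GenClosed H M S T) {a b : V} {ha hb : Bool} (h : GenEdge H M S a ha b hb) :
    T a ha b hb := by
  cases ha <;> cases hb
  · exact hT.of_line h
  · exact hT.of_arrow h
  · exact hT.symm (hT.of_arrow h)
  · exact hT.of_arc h

theorem GenEdge.conn {H : MixedGraph V} (hH : H.Wf) {M S : Set V} {a b : V} {ha hb : Bool}
    (h : GenEdge H M S a ha b hb) : Conn H.Edge M S a ha b hb :=
  GenClosed.of_genEdge (T := Conn H.Edge M S)
    ⟨.base, .symm fun _ _ _ _ h => h.symm hH, fun h₁ ho h₂ _ => .trans h₁ ho h₂⟩ h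

/-- The information carried by a generated edge of a summary graph about its endpoint
`a`. -/
def EndInv (H : MixedGraph V) (C : Set V) (a : V) (ha : Bool) (b : V) (hb : Bool) : Prop :=
  (ha = true → ¬ H.LineEndpoint a) ∧
    (ha = false → a ∈ H.anSet C ∨ H.LineEndpoint a ∨ hb = true ∧ H.anc a b)

theorem mem_anSet_of_anc {G : MixedGraph V} {C : Set V} {a x : V} (h : G.anc a x)
    (hx : x ∈ C ∪ G.anSet C) : a ∈ G.anSet C := by
  rcases hx with hx | ⟨c, hc, hxc⟩
  · exact ⟨x, hx, h⟩
  · exact ⟨c, hc, Relation.TransGen.trans h hxc⟩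

theorem EndInv.trans {H : MixedGraph V} {M C : Set V} {a x b : V} {ha hx hx' hb : Bool}
    (h₁ : EndInv H C a ha x hx) (h₁' : EndInv H C x hx a ha)
    (ho : InnerOk M (C ∪ H.anSet C) hx hx' x) (h₂ : EndInv H C x hx' b hb) :
    EndInv H C a ha b hb := by
  refine ⟨h₁.1, fun e => ?_⟩
  rcases h₁.2 e with h | h | ⟨hx1, hax⟩
  · exact .inl h
  · exact .inr (.inl h)
  · cases hx' with
    | true => exact .inl (mem_anSet_of_anc hax (ho.1 ⟨hx1, rfl⟩))
    | false =>
      rcases h₂.2 rfl with h | h | ⟨hb1, hxb⟩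
      · exact .inl (mem_anSet_of_anc hax (.inr h))
      · exact absurd h (h₁'.1 hx1)
      · exact .inr (.inr ⟨hb1, Relation.TransGen.trans hax hxb⟩)

theorem MixedGraph.Edge.endInv {H : MixedGraph V} (hH : H.IsSG) {C : Set V} {a b : V}
    {ha hb : Bool} (h : H.Edge a ha b hb) : EndInv H C a ha b hb := by
  cases ha
  · refine ⟨by simp, fun _ => .inr ?_⟩
    cases hb
    · exact .inl ⟨b, h⟩
    · exact .inr ⟨rfl, .single h⟩
  · exact ⟨fun _ => hH.not_lineEndpoint h, by simp⟩

theorem GenEdge.endInv_and_ne {H : MixedGraph V} (hH : H.IsSG) {M C : Set V} {a b : V}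
    {ha hb : Bool} (h : GenEdge H M (C ∪ H.anSet C) a ha b hb) :
    EndInv H C a ha b hb ∧ EndInv H C b hb a ha ∧ a ≠ b := by
  refine GenClosed.of_genEdge
    (T := fun a ha b hb => EndInv H C a ha b hb ∧ EndInv H C b hb a ha ∧ a ≠ b) ⟨?_, ?_, ?_⟩ h
  · exact fun h => ⟨h.endInv hH, (h.symm hH.1.1).endInv hH, h.ne hH.1.2.1⟩
  · exact fun ⟨h₁, h₂, h₃⟩ => ⟨h₂, h₁, h₃.symm⟩
  · exact fun ⟨h₁, h₁', _⟩ ho ⟨h₂, h₂', _⟩ hab =>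
      ⟨h₁.trans h₁' ho h₂, h₂'.trans h₂ ho.symm h₁', hab⟩

theorem GenEdge.endInv {H : MixedGraph V} (hH : H.IsSG) {M C : Set V} {a b : V}
    {ha hb : Bool} (h : GenEdge H M (C ∪ H.anSet C) a ha b hb) : EndInv H C a ha b hb :=
  (h.endInv_and_ne hH).1

/-! ### Edges of the generated summary graph -/

theorem edge_alphaSG_iff {H : MixedGraph V} {M C : Set V} {a b : V} {ha hb : Bool} :
    (alphaSG H M C).Edge a ha b hb ↔ a ∈ H.nodes \ (M ∪ C) ∧ b ∈ H.nodes \ (M ∪ C) ∧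
      ∃ ka kb, GenEdge H M (C ∪ H.anSet C) a ka b kb ∧
        (ha = true ↔ ka = true ∧ a ∉ H.anSet C) ∧ (hb = true ↔ kb = true ∧ b ∉ H.anSet C) := by
  have harc : GenArc H M (C ∪ H.anSet C) a b ↔ GenArc H M (C ∪ H.anSet C) b a :=
    ⟨.symm, .symm⟩
  by_cases hma : a ∈ H.anSet C <;> by_cases hmb : b ∈ H.anSet C <;> cases ha <;> cases hb <;>
    simp [MixedGraph.Edge, Step.valid, alphaSG, deheadAt, alphaRG, GenEdge, hma, hmb] <;> tauto

theorem edge_alphaSG_head {H : MixedGraph V} (hH : H.IsSG) {M C : Set V} {a b : V} {hb : Bool}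
    (h : (alphaSG H M C).Edge a true b hb) : a ∉ H.anSet C ∧ ¬ H.LineEndpoint a := by
  obtain ⟨-, -, ka, kb, hk, e, -⟩ := edge_alphaSG_iff.1 h
  obtain ⟨hka, ha⟩ := e.1 rfl
  exact ⟨ha, (hk.endInv hH).1 hka⟩

theorem edge_alphaSG_line {H : MixedGraph V} (hH : H.IsSG) {M C : Set V} {a b : V}
    (h : (alphaSG H M C).Edge a false b false) : a ∈ H.anSet C ∨ H.LineEndpoint a := by
  obtain ⟨-, -, ka, kb, hk, ea, eb⟩ := edge_alphaSG_iff.1 h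
  by_contra! hn
  cases hka : ka with
  | true => exact Bool.false_ne_true (ea.2 ⟨hka, hn.1⟩)
  | false =>
    rcases (hk.endInv hH).2 hka with h | h | ⟨hkb, hab⟩
    · exact hn.1 h
    · exact hn.2 h
    · refine Bool.false_ne_true (eb.2 ⟨hkb, fun hb => hn.1 ?_⟩)
      exact mem_anSet_of_anc hab (.inr hb)

theorem edge_alphaSG_arrow {H : MixedGraph V} (hH : H.IsSG) {M C : Set V} {a b : V}
    (h : (alphaSG H M C).Edge a false b true) (ha : a ∉ H.anSet C) (hla : ¬ H.LineEndpoint a) :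
    H.anc a b := by
  obtain ⟨-, -, ka, kb, hk, ea, eb⟩ := edge_alphaSG_iff.1 h
  have hka : ka = false := by
    by_contra hka
    exact Bool.false_ne_true (ea.2 ⟨by simpa using hka, ha⟩)
  rcases (hk.endInv hH).2 hka with h | h | ⟨-, h⟩
  · exact absurd h ha
  · exact absurd h hla
  · exact h

theorem anc_of_anc_alphaSG {H : MixedGraph V} (hH : H.IsSG) {M C : Set V} {a b : V}
    (h : (alphaSG H M C).anc a b) (ha : a ∉ H.anSet C) (hla : ¬ H.LineEndpoint a) :
    H.anc a b := by
  induction h using Relation.TransGen.head_induction_on with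
  | single h => exact edge_alphaSG_arrow hH h ha hla
  | @head a x h _ ih =>
    have hx := edge_alphaSG_head hH (b := a) (hb := false) h
    exact Relation.TransGen.trans (edge_alphaSG_arrow hH h ha hla) (ih hx.1 hx.2)

theorem anSet_mono {G : MixedGraph V} {C D : Set V} (h : C ⊆ D) : G.anSet C ⊆ G.anSet D :=
  fun _ ⟨c, hc, hac⟩ => ⟨c, h hc, hac⟩

theorem Conn.mono {E : V → Bool → V → Bool → Prop} {M S M' S' : Set V} (hM : M ⊆ M')
    (hS : S ⊆ S') {a b : V} {ha hb : Bool} (h : Conn E M S a ha b hb) :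
    Conn E M' S' a ha b hb := by
  induction h with
  | base h => exact .base h
  | trans _ ho _ ih₁ ih₂ => exact .trans ih₁ ⟨fun h => hS (ho.1 h), fun h => hM (ho.2 h)⟩ ih₂

/-- Connecting walks of the generated graph lift to the original graph. -/
theorem Conn.of_alphaSG {H : MixedGraph V} (hH : H.IsSG) {M C C₁ L L' : Set V}
    (hM : M ⊆ L) (hL : L' ⊆ L) {a b : V} {ha hb : Bool}
    (h : Conn (alphaSG H M C).Edge L' (C₁ ∪ (alphaSG H M C).anSet C₁) a ha b hb) :
    ∃ ka kb, Conn H.Edge L (C ∪ C₁ ∪ H.anSet (C ∪ C₁)) a ka b kb ∧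
      (ha = true ↔ ka = true ∧ a ∉ H.anSet C) ∧ (hb = true ↔ kb = true ∧ b ∉ H.anSet C) ∧
      (hb = true → ¬ H.LineEndpoint b) := by
  induction h with
  | @base a b ha hb h =>
    obtain ⟨-, -, ka, kb, hk, ea, eb⟩ := edge_alphaSG_iff.1 h
    refine ⟨ka, kb, (hk.conn hH.1.1).mono hM ?_, ea, eb, fun e => ?_⟩
    · exact Set.union_subset_union Set.subset_union_left (anSet_mono Set.subset_union_left)
    · exact (hk.symm.endInv hH).1 (eb.1 e).1
  | @trans a x b ha hx hx' hb _ ho _ ih₁ ih₂ =>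
    obtain ⟨ka, kx, h₁, ea, ex, lx⟩ := ih₁
    obtain ⟨kx', kb, h₂, ex', eb, lb⟩ := ih₂
    refine ⟨ka, kb, .trans h₁ ⟨?_, ?_⟩ h₂, ea, eb, lb⟩
    · rintro ⟨rfl, rfl⟩
      by_cases hxC : x ∈ H.anSet C
      · exact .inr (anSet_mono Set.subset_union_left hxC)
      have hxt : hx = true := ex.2 ⟨rfl, hxC⟩
      rcases ho.1 ⟨hxt, ex'.2 ⟨rfl, hxC⟩⟩ with h | ⟨c, hc, hxc⟩
      · exact .inl (.inr h)
      · exact .inr ⟨c, .inr hc, anc_of_anc_alphaSG hH hxc hxC (lx hxt)⟩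
    · intro hk
      exact hL (ho.2 fun h => hk ⟨(ex.1 h.1).1, (ex'.1 h.2).1⟩)

/-! ### Connecting paths of the original graph in the generated graph -/

/-- Along a path, all inner nodes that satisfy the m-connection condition for `M` and `S` can be
eliminated by generating edges. -/
theorem GenEdge.conn_of_walk {H : MixedGraph V} {M S L T : Set V} {w : List (Step V)}
    {a b x : V} {ha hx : Bool} (h : GenEdge H M S a ha x hx)
    (hw : IsWalk H.Edge x w b) (hc : IsConnecting L T w)
    (ho : ∀ s ∈ w.head?, InnerOk L T hx s.hs x) (ha' : a ∉ w.map Step.tgt)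
    (hd : (x :: w.map Step.tgt).Nodup) :
    ∃ hb, Conn (GenEdge H M S) (L \ M) (T \ S) a ha b hb := by
  induction w generalizing a ha x hx with
  | nil =>
    obtain rfl : x = b := hw
    exact ⟨hx, .base h⟩
  | cons s w ih =>
    obtain ⟨rfl, he, hw⟩ := hw
    obtain ⟨hn, hd⟩ := List.nodup_cons.1 hd
    have hc' : IsConnecting L T w ∧ ∀ t ∈ w.head?, InnerOk L T s.ht t.hs s.tgt := by
      cases w with
      | nil => exact ⟨.nil, by simp⟩
      | cons t w =>
        obtain ⟨h₁, h₂⟩ := List.isChain_cons_cons.1 hc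
        exact ⟨h₂, by simpa using h₁⟩
    have ho := ho s rfl
    simp only [List.map_cons, List.mem_cons, not_or] at ha' hn
    by_cases hms : InnerOk M S hx s.hs s.src
    · exact ih (h.trans hms (.base he) ha'.1) hw hc'.1 hc'.2 ha'.2 hd
    · obtain ⟨hb, hcn⟩ := ih (.base he) hw hc'.1 hc'.2 hn.2 hd
      refine ⟨hb, .trans (.base h) ⟨fun e => ⟨ho.1 e, fun hS => hms ?_⟩,
        fun e => ⟨ho.2 e, fun hM => hms ?_⟩⟩ hcn⟩
      · exact ⟨fun _ => hS, fun e' => absurd e e'⟩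
      · exact .of_nonCollider hM e

/-- `u` can take the place of the node `v` in the generated graph: `u = v` if `v` is not
marginalised over, and otherwise `u` is a descendant of `v`. -/
structure Substitute (H : MixedGraph V) (M C C₁ : Set V) (v u : V) : Prop where
  mem : u ∈ H.nodes \ (M ∪ C)
  eq : v ∉ M → u = v
  not_marked : v ∈ M → u ∉ H.anSet C
  edge : v ∈ M → GenEdge H M (C ∪ H.anSet C) v false u true
  anc : v ∈ M → H.anc v u
  collider : v ∉ H.anSet C → v ∈ C₁ ∪ H.anSet C₁ → u ∈ C₁ ∪ (alphaSG H M C).anSet C₁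

theorem Substitute.refl {H : MixedGraph V} {M C C₁ : Set V} {v : V}
    (hv : v ∈ H.nodes \ (M ∪ C)) (h : v ∉ H.anSet C → v ∈ C₁ ∪ H.anSet C₁ →
      v ∈ C₁ ∪ (alphaSG H M C).anSet C₁) : Substitute H M C C₁ v v where
  mem := hv
  eq _ := rfl
  not_marked hM := absurd (.inl hM) hv.2
  edge hM := absurd (.inl hM) hv.2
  anc hM := absurd (.inl hM) hv.2
  collider := h

theorem exists_substitute_of_anc {H : MixedGraph V} (hH : H.IsSG) {M C C₁ : Set V}
    (hC₁ : C₁ ⊆ H.nodes \ (M ∪ C)) {v c : V} (hc : c ∈ C₁) (h : H.anc v c)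
    (hv : v ∉ H.anSet C) (hvC : v ∉ C) : ∃ u, Substitute H M C C₁ v u := by
  have key : ∀ {v x u : V}, H.arrow v x → v ∉ H.anSet C → v ∉ C → Substitute H M C C₁ x u →
      x ∉ C ∪ H.anSet C → u ∈ C₁ ∪ (alphaSG H M C).anSet C₁ → u ∉ H.anSet C →
      ∃ u, Substitute H M C C₁ v u := by
    intro v x u hvx hv hvC hu hx hu₁ hum
    have hanc : H.anc v u := by
      by_cases hxM : x ∈ M
      · exact .head hvx (hu.anc hxM)
      · rw [hu.eq hxM]
        exact .single hvx
    have hvu : v ≠ u := by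
      rintro rfl
      exact hH.2.2 _ hanc
    have hedge : GenEdge H M (C ∪ H.anSet C) v false u true := by
      have hb : GenEdge H M (C ∪ H.anSet C) v false x true := .base hvx
      by_cases hxM : x ∈ M
      · exact hb.trans (.of_nonCollider hxM (by simp)) (hu.edge hxM) hvu
      · rw [hu.eq hxM]
        exact hb
    by_cases hvM : v ∈ M
    · exact ⟨u, hu.mem, fun h => absurd hvM h, fun _ => hum, fun _ => hedge, fun _ => hanc,
        fun _ _ => hu₁⟩
    · have hvn : v ∈ H.nodes \ (M ∪ C) :=
        ⟨(hH.1.1.2.2 _ _ (.inl hvx)).1, fun h => h.elim hvM hvC⟩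
      refine ⟨v, .refl hvn fun _ _ => .inr ?_⟩
      have ha : (alphaSG H M C).arrow v u :=
        edge_alphaSG_iff (ha := false) (hb := true) |>.2
          ⟨hvn, hu.mem, false, true, hedge, by simp, by simpa using hum⟩
      rcases hu₁ with hu₁ | ⟨c, hc, huc⟩
      · exact ⟨u, hu₁, .single ha⟩
      · exact ⟨c, hc, .head ha huc⟩
  have hnext : ∀ {v x : V}, H.arrow v x → v ∉ H.anSet C → x ∉ C ∪ H.anSet C := fun hvx hv hx =>
    hv (mem_anSet_of_anc (.single hvx) hx)
  induction h using Relation.TransGen.head_induction_on with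
  | single hvx =>
    have hx := hnext hvx hv
    exact key hvx hv hvC (.refl (hC₁ hc) fun _ _ => .inl hc) hx (.inl hc) fun h => hx (.inr h)
  | @head v x hvx hxc ih =>
    have hx := hnext hvx hv
    obtain ⟨u, hu⟩ := ih (fun h => hx (.inr h)) fun h => hx (.inl h)
    refine key hvx hv hvC hu hx (hu.collider (fun h => hx (.inr h)) (.inr ⟨c, hc, hxc⟩)) ?_
    by_cases hxM : x ∈ M
    · exact hu.not_marked hxM
    · rw [hu.eq hxM]
      exact fun h => hx (.inr h)

theorem exists_substitute {H : MixedGraph V} (hH : H.IsSG) {M C C₁ : Set V}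
    (hC₁ : C₁ ⊆ H.nodes \ (M ∪ C)) {v : V} (hv : v ∈ H.nodes \ (M ∪ C) ∨
      v ∉ C ∪ H.anSet C ∧ v ∈ C₁ ∪ H.anSet C₁) : ∃ u, Substitute H M C C₁ v u := by
  by_cases h : v ∉ C ∪ H.anSet C ∧ v ∈ C₁ ∪ H.anSet C₁
  · rcases h.2 with h₁ | ⟨c, hc, hvc⟩
    · exact ⟨v, .refl (hC₁ h₁) fun _ _ => .inl h₁⟩
    · exact exists_substitute_of_anc hH hC₁ hc hvc (fun h' => h.1 (.inr h'))
        fun h' => h.1 (.inl h')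
  · have hv := hv.resolve_right h
    exact ⟨v, .refl hv fun h₁ h₂ => absurd ⟨fun h₃ => h₃.elim (fun h₄ => hv.2 (.inr h₄)) h₁, h₂⟩ h⟩

/-- The edges of `α_SG(H;M,C)` together with arc loops at the nodes that may carry arrowheads. -/
def LoopEdge (H : MixedGraph V) (M C : Set V) (a : V) (ha : Bool) (b : V) (hb : Bool) : Prop :=
  (alphaSG H M C).Edge a ha b hb ∨
    a = b ∧ ha = true ∧ hb = true ∧ a ∉ H.anSet C ∧ ¬ H.LineEndpoint a

theorem edge_alphaSG_symm {H : MixedGraph V} {M C : Set V} {a b : V} {ha hb : Bool}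
    (h : (alphaSG H M C).Edge a ha b hb) : (alphaSG H M C).Edge b hb a ha := by
  obtain ⟨hna, hnb, ka, kb, hk, ea, eb⟩ := edge_alphaSG_iff.1 h
  exact edge_alphaSG_iff.2 ⟨hnb, hna, kb, ka, hk.symm, eb, ea⟩

theorem LoopEdge.symm {H : MixedGraph V} {M C : Set V} {a b : V} {ha hb : Bool}
    (h : LoopEdge H M C a ha b hb) : LoopEdge H M C b hb a ha := by
  rcases h with h | ⟨rfl, h₁, h₂, h⟩
  · exact .inl (edge_alphaSG_symm h)
  · exact .inr ⟨rfl, h₂, h₁, h⟩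

/-- Replacing an endpoint of a generated edge by its substitute. -/
theorem GenEdge.substitute {H : MixedGraph V} (hH : H.IsSG) {M C C₁ : Set V} {a b u : V}
    {ha hb : Bool} (h : GenEdge H M (C ∪ H.anSet C) a ha b hb) (hu : Substitute H M C C₁ a u)
    (ha' : a ∈ M → ha = true) : GenEdge H M (C ∪ H.anSet C) u ha b hb ∨
      a ∈ M ∧ u = b ∧ hb = true ∧ b ∉ H.anSet C ∧ ¬ H.LineEndpoint b := by
  by_cases haM : a ∈ M
  · obtain rfl := ha' haM
    by_cases hub : u = b
    · subst hub
      have hl := ((hu.edge haM).symm.endInv hH).1 rfl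
      refine .inr ⟨haM, rfl, ?_, hu.not_marked haM, hl⟩
      by_contra hb1
      rcases (h.symm.endInv hH).2 (by simpa using hb1) with h' | h' | ⟨-, h'⟩
      · exact hu.not_marked haM h'
      · exact hl h'
      · exact hH.2.2 _ (Relation.TransGen.trans h' (hu.anc haM))
    · exact .inl ((hu.edge haM).symm.trans (.of_nonCollider haM (by simp)) h hub)
  · rw [hu.eq haM]
    exact .inl h

theorem GenEdge.loopEdge {H : MixedGraph V} (hH : H.IsSG) {M C C₁ : Set V} {a b u v : V}
    {ha hb ha' hb' : Bool} (h : GenEdge H M (C ∪ H.anSet C) a ha b hb)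
    (hu : Substitute H M C C₁ a u) (hv : Substitute H M C C₁ b v)
    (ha₁ : a ∈ M → ha = true) (hb₁ : b ∈ M → hb = true)
    (ea : ha' = true ↔ ha = true ∧ u ∉ H.anSet C)
    (eb : hb' = true ↔ hb = true ∧ v ∉ H.anSet C) : LoopEdge H M C u ha' v hb' := by
  rcases h.substitute hH hu ha₁ with h₁ | ⟨haM, rfl, hb1, hm, hl⟩
  · rcases h₁.symm.substitute hH hv hb₁ with h₂ | ⟨hbM, rfl, ha1, hm, hl⟩
    · exact .inl (edge_alphaSG_iff.2 ⟨hu.mem, hv.mem, ha, hb, h₂.symm, ea, eb⟩)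
    · exact .inr ⟨rfl, ea.2 ⟨ha1, hm⟩, eb.2 ⟨hb₁ hbM, hm⟩, hm, hl⟩
  · obtain rfl := hv.eq fun hbM => hu.mem.2 (.inl hbM)
    exact .inr ⟨rfl, ea.2 ⟨ha₁ haM, hm⟩, eb.2 ⟨hb1, hm⟩, hm, hl⟩

theorem Conn.loopEdge {H : MixedGraph V} (hH : H.IsSG) {M C C₁ L : Set V}
    (hL : L ⊆ H.nodes \ (M ∪ C)) {f : V → V}
    (hf : ∀ v, (v ∈ H.nodes \ (M ∪ C) ∨ v ∉ C ∪ H.anSet C ∧ v ∈ C₁ ∪ H.anSet C₁) →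
      Substitute H M C C₁ v (f v)) {a b : V} {ha hb : Bool}
    (h : Conn (GenEdge H M (C ∪ H.anSet C)) L
      ((C ∪ C₁ ∪ H.anSet (C ∪ C₁)) \ (C ∪ H.anSet C)) a ha b hb) :
    (a ∈ H.nodes \ (M ∪ C) ∨ a ∉ C ∪ H.anSet C ∧ a ∈ C₁ ∪ H.anSet C₁) →
    (b ∈ H.nodes \ (M ∪ C) ∨ b ∉ C ∪ H.anSet C ∧ b ∈ C₁ ∪ H.anSet C₁) →
    (a ∈ M → ha = true) → (b ∈ M → hb = true) →
    ∀ ha' hb', (ha' = true ↔ ha = true ∧ f a ∉ H.anSet C) →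
      (hb' = true ↔ hb = true ∧ f b ∉ H.anSet C) →
      Conn (LoopEdge H M C) L (C₁ ∪ (alphaSG H M C).anSet C₁) (f a) ha' (f b) hb' := by
  classical
  induction h with
  | base h =>
    intro ga gb ha₁ hb₁ ha' hb' ea eb
    exact .base (h.loopEdge hH (hf _ ga) (hf _ gb) ha₁ hb₁ ea eb)
  | @trans a x b ha hx hx' hb _ ho _ ih₁ ih₂ =>
    intro ga gb ha₁ hb₁ ha' hb' ea eb
    have hcol : hx = true ∧ hx' = true → x ∉ C ∪ H.anSet C ∧ x ∈ C₁ ∪ H.anSet C₁ := by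
      intro e
      obtain ⟨h₁, h₂⟩ := ho.1 e
      refine ⟨h₂, ?_⟩
      rcases h₁ with (h₁ | h₁) | ⟨c, hc | hc, hxc⟩
      · exact absurd (.inl h₁) h₂
      · exact .inl h₁
      · exact absurd (.inr ⟨c, hc, hxc⟩) h₂
      · exact .inr ⟨c, hc, hxc⟩
    have gx : x ∈ H.nodes \ (M ∪ C) ∨ x ∉ C ∪ H.anSet C ∧ x ∈ C₁ ∪ H.anSet C₁ := by
      by_cases e : hx = true ∧ hx' = true
      · exact .inr (hcol e)
      · exact .inl (hL (ho.2 e))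
    have hxM : x ∈ M → hx = true ∧ hx' = true := fun hM => by
      by_contra e
      exact (hL (ho.2 e)).2 (.inl hM)
    have hmark : hx = true ∧ hx' = true → f x ∉ H.anSet C := by
      intro e
      by_cases hM : x ∈ M
      · exact (hf x gx).not_marked hM
      · rw [(hf x gx).eq hM]
        exact fun h => (hcol e).1 (.inr h)
    refine .trans (ih₁ ga gx ha₁ (fun h => (hxM h).1) ha' (hx && decide (f x ∉ H.anSet C)) ea
      (by simp)) ⟨?_, ?_⟩ (ih₂ gx gb (fun h => (hxM h).2) hb₁
      (hx' && decide (f x ∉ H.anSet C)) hb' (by simp) eb)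
    · intro e
      simp only [Bool.and_eq_true] at e
      have e' := hcol ⟨e.1.1, e.2.1⟩
      exact (hf x gx).collider (fun h => e'.1 (.inr h)) e'.2
    · intro e
      have e' : ¬ (hx = true ∧ hx' = true) := fun e' => e (by simp [e'.1, e'.2, hmark e'])
      rw [(hf x gx).eq fun hM => e' (hxM hM)]
      exact ho.2 e'

theorem exists_mConnPath_alphaSG {H : MixedGraph V} (hH : H.IsSG) {M C C₁ L : Set V}
    (hC₁ : C₁ ⊆ H.nodes \ (M ∪ C)) (hL : L \ M ⊆ H.nodes \ (M ∪ C)) {a b : V}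
    (ha : a ∈ H.nodes \ (M ∪ C)) (hb : b ∈ H.nodes \ (M ∪ C)) (hab : a ≠ b)
    {w : List (Step V)} (hw : IsPath H a b w) (hc : MConnPath H L (C ∪ C₁) w) :
    ∃ w', IsPath (alphaSG H M C) a b w' ∧ MConnPath (alphaSG H M C) (L \ M) C₁ w' := by
  classical
  obtain ⟨hne, hw, hd⟩ := isPath_iff.1 hw
  obtain ⟨s, w, rfl⟩ := List.exists_cons_of_ne_nil hne
  obtain ⟨rfl, he, hw⟩ := hw
  obtain ⟨hn, hd⟩ := List.nodup_cons.1 hd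
  have hc' : IsConnecting L (C ∪ C₁ ∪ H.anSet (C ∪ C₁)) w ∧
      ∀ t ∈ w.head?, InnerOk L (C ∪ C₁ ∪ H.anSet (C ∪ C₁)) s.ht t.hs s.tgt := by
    cases w with
    | nil => exact ⟨.nil, by simp⟩
    | cons t w =>
      obtain ⟨h₁, h₂⟩ := List.isChain_cons_cons.1 (mConnPath_iff.1 hc)
      exact ⟨h₂, by simpa using h₁⟩
  simp only [List.map_cons, List.mem_cons, not_or] at hn
  obtain ⟨kb, hconn⟩ := (GenEdge.base (M := M) (S := C ∪ H.anSet C) he).conn_of_walk hw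
    hc'.1 hc'.2 hn.2 hd
  have hex : ∀ v, ∃ u, (v ∈ H.nodes \ (M ∪ C) ∨ v ∉ C ∪ H.anSet C ∧ v ∈ C₁ ∪ H.anSet C₁) →
      Substitute H M C C₁ v u := by
    intro v
    by_cases hv : v ∈ H.nodes \ (M ∪ C) ∨ v ∉ C ∪ H.anSet C ∧ v ∈ C₁ ∪ H.anSet C₁
    · obtain ⟨u, hu⟩ := exists_substitute hH hC₁ hv
      exact ⟨u, fun _ => hu⟩
    · exact ⟨v, fun h => absurd h hv⟩
  choose f hf using hex
  have haM : s.src ∉ M := fun h => ha.2 (.inl h)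
  have hbM : b ∉ M := fun h => hb.2 (.inl h)
  have hloop := hconn.loopEdge hH hL hf (.inl ha) (.inl hb) (fun h => absurd h haM)
    (fun h => absurd h hbM) (s.hs && decide (f s.src ∉ H.anSet C))
    (kb && decide (f b ∉ H.anSet C)) (by simp) (by simp)
  rw [(hf _ (.inl ha)).eq haM, (hf _ (.inl hb)).eq hbM] at hloop
  refine hloop.exists_path (fun _ _ _ _ h => h.symm) ?_ ?_ ?_ hab
  · rintro x y z k (h | h) h'
    · have hx : x ∉ H.anSet C ∧ ¬ H.LineEndpoint x := by
        rcases h' with h' | h'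
        · exact edge_alphaSG_head hH h'
        · exact h'.2.2.2
      exact (edge_alphaSG_line hH h).elim hx.1 hx.2
    · exact Bool.false_ne_true h.2.1
  · rintro x kx y ky (h | h) hxy
    · exact h
    · exact absurd h.1 hxy
  · rintro x (h | h)
    · obtain ⟨-, -, kx, ky, hk, -⟩ := edge_alphaSG_iff.1 h
      exact (hk.endInv_and_ne hH).2.2 rfl
    · exact Bool.false_ne_true h.2.1

theorem exists_mConnPath_of_alphaSG {H : MixedGraph V} (hH : H.IsSG) {M C C₁ L L' : Set V}
    (hM : M ⊆ L) (hL : L' ⊆ L) {a b : V} (hab : a ≠ b) {w : List (Step V)}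
    (hw : IsPath (alphaSG H M C) a b w) (hc : MConnPath (alphaSG H M C) L' C₁ w) :
    ∃ w', IsPath H a b w' ∧ MConnPath H L (C ∪ C₁) w' := by
  obtain ⟨hne, hw, -⟩ := isPath_iff.1 hw
  obtain ⟨s, w, rfl⟩ := List.exists_cons_of_ne_nil hne
  obtain ⟨hj, hconn⟩ := hw.conn (mConnPath_iff.1 hc)
  obtain ⟨ka, kb, h, -⟩ := hconn.of_alphaSG hH hM hL
  refine h.exists_path (fun _ _ _ _ h => h.symm hH.1.1) ?_ (fun _ _ _ _ h _ => h) ?_ hab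
  · exact fun x y z k h h' => hH.not_lineEndpoint h' ⟨y, h⟩
  · exact fun x h => h.ne hH.1.2.1 rfl

/-- (Theorem 4) Graphs generated by `α_SG` induce the
marginal and conditional independence model: for a summary graph `H` and
pairwise disjoint subsets `A`, `B`, `C`, `C₁`, `M` of its node set,
`A ⊥_m B | C₁` holds in `α_SG(H;M,C)` iff `A ⊥_m B | C ∪ C₁` holds in `H`. -/
theorem stmt_12 {V : Type} (H : MixedGraph V) (A B C C₁ M : Set V)
    (hH : H.IsSG)
    (hA : A ⊆ H.nodes) (hB : B ⊆ H.nodes) (hC : C ⊆ H.nodes)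
    (hC₁ : C₁ ⊆ H.nodes) (hM : M ⊆ H.nodes)
    (hAB : Disjoint A B) (hAC : Disjoint A C) (hAC₁ : Disjoint A C₁)
    (hAM : Disjoint A M) (hBC : Disjoint B C) (hBC₁ : Disjoint B C₁)
    (hBM : Disjoint B M) (hCC₁ : Disjoint C C₁) (hCM : Disjoint C M)
    (hC₁M : Disjoint C₁ M) :
    MSep (alphaSG H M C) A B C₁ ↔ MSep H A B (C ∪ C₁) := by
  have hsub : ∀ {X : Set V}, X ⊆ H.nodes → Disjoint X M → Disjoint X C →
      X ⊆ H.nodes \ (M ∪ C) := fun hX hXM hXC x hx =>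
    ⟨hX hx, fun h => h.elim (Set.disjoint_left.1 hXM hx) (Set.disjoint_left.1 hXC hx)⟩
  have hset : (alphaSG H M C).nodes \ (A ∪ B ∪ C₁) = (H.nodes \ (A ∪ B ∪ (C ∪ C₁))) \ M := by
    ext x
    simp only [alphaSG, deheadAt, alphaRG, Set.mem_sdiff, Set.mem_union]
    tauto
  have hML : M ⊆ H.nodes \ (A ∪ B ∪ (C ∪ C₁)) := by
    refine fun x hx => ⟨hM hx, ?_⟩
    rintro ((h | h) | h | h)
    · exact Set.disjoint_left.1 hAM h hx
    · exact Set.disjoint_left.1 hBM h hx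
    · exact Set.disjoint_left.1 hCM h hx
    · exact Set.disjoint_left.1 hC₁M h hx
  unfold MSep
  rw [hset]
  constructor
  · intro h i hi j hj w hw hc
    obtain ⟨w', hw', hc'⟩ := exists_mConnPath_alphaSG hH (hsub hC₁ hC₁M hCC₁.symm)
      (fun x hx => ⟨hx.1.1, fun h' => h'.elim hx.2 fun h' => hx.1.2 (.inr (.inl h'))⟩)
      (hsub hA hAM hAC hi) (hsub hB hBM hBC hj) (hAB.ne_of_mem hi hj) hw hc
    exact h i hi j hj w' hw' hc'
  · intro h i hi j hj w hw hc
    obtain ⟨w', hw', hc'⟩ := exists_mConnPath_of_alphaSG hH hML Set.sdiff_subset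
      (hAB.ne_of_mem hi hj) hw hc
    exact h i hi j hj w' hw' hc'

end StableMixedGraphs
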